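/- Let k be a field and n ≥ 1. The quotient of the polynomial ring k[x_1,…,x_n,y_1,…,y_n] by the ideal generated by all 2×2 minors x_i·y_j − x_j·y_i of the generic 2×n matrix has Krull dimension n + 1. (This is the paper's claim that the fibres of C^{sing}_{a,b} → P^n, cut out inside a product of projective spaces by c_0 = 0, d_0 = 0 and the 2×2 minor equations, have codimension n + 1: equivalently, the ideal of 2×2 minors in 2n variables has height n − 1.) -/

import Mathlib

open MvPolynomial in
/-- The ideal of 2×2 minors of the generic 2×n matrix. -/
noncomputable abbrev genericMinors (k : Type*) [Field k] (n : ℕ) :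
    Ideal (MvPolynomial (Fin n ⊕ Fin n) k) :=
  Ideal.span { p : MvPolynomial (Fin n ⊕ Fin n) k |
    ∃ i j : Fin n, p = X (Sum.inl i) * X (Sum.inr j) - X (Sum.inl j) * X (Sum.inr i) }

/-- The valuative criterion for integrality over the image of a ring in a field. -/
theorem RingHom.isIntegralElem_of_forall_valuationSubring {R K : Type*} [CommRing R] [Field K]
    (f : R →+* K) (x : K)
    (h : ∀ V : ValuationSubring K, (∀ r, f r ∈ V) → x ∈ V) : f.IsIntegralElem x := by
  have hx : x ∈ (integralClosure (Subring.closure (Set.range f)) K).toSubring := by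
    rw [← iInf_valuationSubring_superset, Subring.mem_iInf]
    exact fun V ↦ h V.1 fun r ↦ V.2 ⟨r, rfl⟩
  obtain ⟨p, hp, hpx⟩ : _root_.IsIntegral (Subring.closure (Set.range f)) x := hx
  have hcl : Subring.closure (Set.range f) = f.range := by
    rw [← RingHom.coe_range, Subring.closure_eq]
  have hlift : p.map (algebraMap _ K) ∈ Polynomial.lifts f := by
    rw [Polynomial.lifts_iff_coeff_lifts]
    intro i
    rw [Polynomial.coeff_map]
    exact (hcl ▸ (p.coeff i).2 : (p.coeff i : K) ∈ f.range)
  obtain ⟨q, hq, -, hqm⟩ :=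
    Polynomial.lifts_and_natDegree_eq_and_monic hlift (hp.map _)
  refine ⟨q, hqm, ?_⟩
  rw [← Polynomial.eval_map, hq, Polynomial.eval_map]
  exact hpx

/-- A ring `A` has dimension at most that of `R` if, under every map from `A` to a field, each
valuation subring containing the image of `R` contains the image of `A`. -/
theorem ringKrullDim_le_of_forall_valuationSubring {R : Type*} {A : Type*} [CommRing R]
    [CommRing A] (f : R →+* A)
    (h : ∀ (P : Ideal A) [P.IsPrime] (V : ValuationSubring P.ResidueField),
      (∀ r, algebraMap A P.ResidueField (f r) ∈ V) → ∀ a, algebraMap A P.ResidueField a ∈ V) :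
    ringKrullDim A ≤ ringKrullDim R := by
  refine Order.krullDim_le_of_strictMono (PrimeSpectrum.comap f) fun P Q hPQ ↦ ?_
  have hPQ' : P.asIdeal < Q.asIdeal := hPQ
  obtain ⟨hle, a, haQ, haP⟩ := SetLike.lt_iff_le_and_exists.mp hPQ'
  obtain ⟨p, hp, hpa⟩ := RingHom.isIntegralElem_of_forall_valuationSubring
    ((algebraMap A P.asIdeal.ResidueField).comp f) (algebraMap A _ a)
    fun V hV ↦ h P.asIdeal V hV a
  refine Ideal.comap_lt_comap_of_root_mem_sdiff (f := f) hle ⟨haQ, haP⟩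
    (Polynomial.map_monic_ne_zero hp) ?_
  rwa [← Polynomial.hom_eval₂, Ideal.algebraMap_residueField_eq_zero] at hpa

/-- If the rows `x`, `y` of a matrix of rank at most one over a field are such that `x 0`,
`y (last)` and all the `x (i + 1) - y i` lie in a valuation subring, then so do all entries. -/
theorem ValuationSubring.mem_of_minors_eq_zero {K : Type*} [Field K] (V : ValuationSubring K)
    {m : ℕ} {x y : Fin (m + 1) → K} (hxy : ∀ i j, x i * y j = x j * y i)
    (hx : x 0 ∈ V) (hy : y (Fin.last m) ∈ V)
    (hd : ∀ i : Fin m, x i.succ - y i.castSucc ∈ V) : (∀ i, x i ∈ V) ∧ ∀ i, y i ∈ V := by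
  have key : ∃ r ∈ V, (∀ i, y i = r * x i) ∨ ∀ i, x i = r * y i := by
    by_cases h0 : ∀ i, x i = 0
    · exact ⟨0, V.zero_mem, Or.inr fun i ↦ by simp [h0 i]⟩
    push Not at h0
    obtain ⟨l, hl⟩ := h0
    have hr : ∀ i, y i = y l / x l * x i := fun i ↦ by
      field_simp
      linear_combination hxy l i
    rcases V.mem_or_inv_mem (y l / x l) with h | h
    · exact ⟨_, h, Or.inl hr⟩
    by_cases hyl : y l = 0
    · exact ⟨0, V.zero_mem, Or.inl fun i ↦ by rw [hr i, hyl, zero_div]⟩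
    · refine ⟨_, h, Or.inr fun i ↦ ?_⟩
      rw [hr i, inv_mul_cancel_left₀ (div_ne_zero hyl hl)]
  obtain ⟨r, hr, h | h⟩ := key
  · have hx' : ∀ i, x i ∈ V := by
      intro i
      induction i using Fin.induction with
      | zero => exact hx
      | succ i ih =>
        have := V.add_mem _ _ (hd i) (h i.castSucc ▸ V.mul_mem _ _ hr ih)
        rwa [sub_add_cancel] at this
    exact ⟨hx', fun i ↦ h i ▸ V.mul_mem _ _ hr (hx' i)⟩
  · have hy' : ∀ i, y i ∈ V := by
      intro i
      induction i using Fin.reverseInduction with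
      | last => exact hy
      | cast i ih =>
        have := V.toSubring.sub_mem (h i.succ ▸ V.mul_mem _ _ hr ih : x i.succ ∈ V) (hd i)
        rwa [sub_sub_cancel] at this
    exact ⟨fun i ↦ h i ▸ V.mul_mem _ _ hr (hy' i), hy'⟩

open MvPolynomial in
theorem ringKrullDim_quotient_genericMinors_le (k : Type*) [Field k] (m : ℕ) :
    ringKrullDim (MvPolynomial (Fin (m + 1) ⊕ Fin (m + 1)) k ⧸ genericMinors k (m + 1)) ≤
      (m + 1 : ℕ) + 1 := by
  let I := genericMinors k (m + 1)
  let x (i : Fin (m + 1)) : MvPolynomial (Fin (m + 1) ⊕ Fin (m + 1)) k := X (Sum.inl i)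
  let y (i : Fin (m + 1)) : MvPolynomial (Fin (m + 1) ⊕ Fin (m + 1)) k := X (Sum.inr i)
  let c : Option (Fin (m + 1)) → MvPolynomial (Fin (m + 1) ⊕ Fin (m + 1)) k := fun o ↦
    o.elim (y (Fin.last m)) (Fin.cases (x 0) fun i ↦ x i.succ - y i.castSucc)
  let f : MvPolynomial (Option (Fin (m + 1))) k →+* _ ⧸ I :=
    (Ideal.Quotient.mk I).comp (aeval (R := k) c).toRingHom
  have hf (o) : f (X o) = Ideal.Quotient.mk I (c o) := by simp [f]
  have hfC (a) : f (C a) = Ideal.Quotient.mk I (C a) := by simp [f, algebraMap_eq]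
  refine (ringKrullDim_le_of_forall_valuationSubring f fun P _ V hV a ↦ ?_).trans (by simp)
  let φ : MvPolynomial (Fin (m + 1) ⊕ Fin (m + 1)) k →+* P.ResidueField :=
    (algebraMap (_ ⧸ I) P.ResidueField).comp (Ideal.Quotient.mk I)
  have hc (o) : φ (c o) ∈ V := by simpa only [hf, φ, RingHom.comp_apply] using hV (X o)
  have hxy (i j) : φ (x i) * φ (y j) = φ (x j) * φ (y i) := by
    rw [← sub_eq_zero, ← map_mul, ← map_mul, ← map_sub]
    have : Ideal.Quotient.mk I (x i * y j - x j * y i) = 0 :=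
      Ideal.Quotient.eq_zero_iff_mem.mpr (Ideal.subset_span ⟨i, j, rfl⟩)
    rw [RingHom.comp_apply, this, map_zero]
  obtain ⟨hx, hy⟩ := V.mem_of_minors_eq_zero hxy (hc (some 0)) (hc none)
    fun i ↦ by simpa [c] using hc (some i.succ)
  obtain ⟨p, rfl⟩ := Ideal.Quotient.mk_surjective a
  change φ p ∈ V
  induction p using MvPolynomial.induction_on with
  | C a => simpa only [hfC, φ, RingHom.comp_apply] using hV (C a)
  | add p q hp hq => exact map_add φ p q ▸ V.add_mem _ _ hp hq
  | mul_X p i hp =>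
    rw [map_mul]
    exact V.mul_mem _ _ hp (i.rec hx hy)

/-- If `I` lies in the kernel of a map `g` to a domain, and a map `e` with `e ∘ g` surjective kills
some `g r ≠ 0`, then the quotient by `I` has larger dimension than the target of `e`. -/
theorem ringKrullDim_succ_le_ringKrullDim_quotient {S T U : Type*} [CommRing S] [CommRing T]
    [IsDomain T] [CommRing U] {I : Ideal S} (g : S →+* T) (hI : I ≤ RingHom.ker g) (e : T →+* U)
    (he : Function.Surjective (e.comp g)) {r : S} (hr : g r ≠ 0) (her : e (g r) = 0) :
    ringKrullDim U + 1 ≤ ringKrullDim (S ⧸ I) := by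
  have hg : ∀ p ∈ I, g.rangeRestrict p = 0 := fun p hp ↦ Subtype.ext (hI hp)
  refine le_trans ?_ (ringKrullDim_le_of_surjective (Ideal.Quotient.lift I g.rangeRestrict hg)
    (Ideal.Quotient.lift_surjective_of_surjective _ _ g.rangeRestrict_surjective))
  refine ringKrullDim_succ_le_of_surjective (e.comp g.range.subtype) (fun u ↦ ?_)
    (r := g.rangeRestrict r)
    (mem_nonZeroDivisors_of_ne_zero fun h ↦ hr (congrArg Subtype.val h)) her
  obtain ⟨s, hs⟩ := he u
  exact ⟨g.rangeRestrict s, hs⟩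

open MvPolynomial in
theorem le_ringKrullDim_quotient_genericMinors (k : Type*) [Field k] (n : ℕ) (hn : 1 ≤ n) :
    (n : WithBot ℕ∞) + 1 ≤
      ringKrullDim (MvPolynomial (Fin n ⊕ Fin n) k ⧸ genericMinors k n) := by
  let g : MvPolynomial (Fin n ⊕ Fin n) k →ₐ[k] Polynomial (MvPolynomial (Fin n) k) :=
    aeval (Sum.elim (fun i ↦ Polynomial.C (X i)) fun i ↦ Polynomial.C (X i) * Polynomial.X)
  have hgl (i) : g (X (Sum.inl i)) = Polynomial.C (X i) := by simp [g]
  have hgr (i) : g (X (Sum.inr i)) = Polynomial.C (X i) * Polynomial.X := by simp [g]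
  have hI : genericMinors k n ≤ RingHom.ker g.toRingHom := by
    refine Ideal.span_le.mpr ?_
    rintro _ ⟨i, j, rfl⟩
    change g _ = 0
    rw [map_sub, map_mul, map_mul, hgl, hgl, hgr, hgr]
    ring
  have hcomp : g.comp (rename Sum.inl) = Polynomial.CAlgHom := by
    ext i : 1
    simp [hgl]
  have hdim : ringKrullDim (MvPolynomial (Fin n) k) = n := by simp
  rw [← hdim]
  refine ringKrullDim_succ_le_ringKrullDim_quotient g.toRingHom hI Polynomial.constantCoeff
    (fun p ↦ ⟨rename Sum.inl p, ?_⟩) (r := X (Sum.inr ⟨0, hn⟩)) ?_ ?_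
  · change Polynomial.constantCoeff (g.comp (rename Sum.inl) p) = p
    rw [hcomp]
    simp
  · change g _ ≠ 0
    simp [hgr]
  · change Polynomial.constantCoeff (g _) = 0
    simp [hgr]

/-- The quotient of k[x_1,…,x_n,y_1,…,y_n] by the ideal of 2×2 minors of the generic
2×n matrix has Krull dimension n + 1. -/
theorem minors_quotient_krullDim (k : Type*) [Field k] (n : ℕ) (hn : 1 ≤ n) :
    ringKrullDim
      (MvPolynomial (Fin n ⊕ Fin n) k ⧸
        Ideal.span { p : MvPolynomial (Fin n ⊕ Fin n) k |
          ∃ i j : Fin n,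
            p = MvPolynomial.X (Sum.inl i) * MvPolynomial.X (Sum.inr j) -
                MvPolynomial.X (Sum.inl j) * MvPolynomial.X (Sum.inr i) }) = n + 1 := by
  refine le_antisymm ?_ (le_ringKrullDim_quotient_genericMinors k n hn)
  obtain ⟨m, rfl⟩ := Nat.exists_eq_add_of_le' hn
  exact ringKrullDim_quotient_genericMinors_le k m
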